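/- There exist constants c₁, c₂ > 0 and N such that for all n ≥ N, the number of distinct orientations of the n-cube that arise as the orientation induced by LCP(M,q) for some n×n P-matrix M and some nondegenerate vector q ∈ ℝ^n (the P-USOs) lies between 2^{c₁·n³} and 2^{c₂·n³}; that is, the number of n-dimensional P-USOs is 2^{Θ(n³)}. -/

import Mathlib

open Matrix BigOperators

/-- A vertex of the `n`-cube: a bit vector of length `n`. -/
abbrev Vertex (n : ℕ) := Fin n → Bool

/-- An orientation of the `n`-cube, given by its "out-map":
`φ v i = true` means that the edge `{v, v ⊕ i}` is directed from `v` to `v ⊕ i`. -/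
abbrev CubeOrientation (n : ℕ) := Vertex n → Fin n → Bool

/-- `v ⊕ i`: flip the `i`-th bit of `v`. -/
def vflip {n : ℕ} (v : Vertex n) (i : Fin n) : Vertex n :=
  Function.update v i (!(v i))

/-- `u` belongs to the subcube with base vertex `v` and coordinate set `C`. -/
def InSubcube {n : ℕ} (v : Vertex n) (C : Finset (Fin n)) (u : Vertex n) : Prop :=
  ∀ j, j ∉ C → u j = v j

/-- `u` is a sink of the subcube `(v, C)`: all subcube edges at `u` are incoming. -/
def IsSink {n : ℕ} (φ : CubeOrientation n) (v : Vertex n) (C : Finset (Fin n))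
    (u : Vertex n) : Prop :=
  InSubcube v C u ∧ ∀ i ∈ C, φ u i = false

/-- `u` is a source of the subcube `(v, C)`: all subcube edges at `u` are outgoing. -/
def IsSource {n : ℕ} (φ : CubeOrientation n) (v : Vertex n) (C : Finset (Fin n))
    (u : Vertex n) : Prop :=
  InSubcube v C u ∧ ∀ i ∈ C, φ u i = true

/-- Unique-sink orientation: every subcube has a unique sink. -/
def IsUSO {n : ℕ} (φ : CubeOrientation n) : Prop :=
  ∀ (v : Vertex n) (C : Finset (Fin n)), ∃! u, IsSink φ v C u

/-- One directed step along an edge of the orientation. -/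
def OrientStep {n : ℕ} (φ : CubeOrientation n) (u w : Vertex n) : Prop :=
  ∃ i, φ u i = true ∧ w = vflip u i

/-- Acyclicity: no directed cycle. -/
def IsAcyclic {n : ℕ} (φ : CubeOrientation n) : Prop :=
  ∀ u, ¬ Relation.TransGen (OrientStep φ) u u

/-- Local uniformity of an orientation. -/
def LocallyUniform {n : ℕ} (φ : CubeOrientation n) : Prop :=
  (∀ (u : Vertex n) (i j : Fin n), i ≠ j → u i = false → u j = false →
      φ u i = true → φ u j = true →
      φ (vflip u i) j = true ∧ φ (vflip u j) i = true) ∧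
  (∀ (u : Vertex n) (i j : Fin n), i ≠ j → u i = false → u j = false →
      φ (vflip u i) i = true → φ (vflip u j) j = true →
      φ (vflip (vflip u i) j) j = true ∧ φ (vflip (vflip u j) i) i = true)

/-- `p` is a directed path from `s` to `t` inside the subcube `(v, C)`. -/
def IsDirPathIn {n : ℕ} (φ : CubeOrientation n) (v : Vertex n) (C : Finset (Fin n))
    (s t : Vertex n) (p : List (Vertex n)) : Prop :=
  p.head? = some s ∧ p.getLast? = some t ∧ p.Nodup ∧
  (∀ u ∈ p, InSubcube v C u) ∧
  p.Chain' (fun a b => ∃ i ∈ C, φ a i = true ∧ b = vflip a i)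

/-- The Holt–Klee property: in every subcube of dimension `d`, there are `d` directed
paths from the source to the sink, pairwise sharing no vertex besides source and sink. -/
def HoltKlee {n : ℕ} (φ : CubeOrientation n) : Prop :=
  IsUSO φ ∧
  ∀ (v : Vertex n) (C : Finset (Fin n)) (s t : Vertex n),
    IsSource φ v C s → IsSink φ v C t →
    ∃ P : Fin C.card → List (Vertex n),
      (∀ k, IsDirPathIn φ v C s t (P k)) ∧
      ∀ k l, k ≠ l → ∀ u, u ∈ P k → u ∈ P l → u = s ∨ u = t

/-- `φ^{(F)}`: reverse all edges in the coordinates belonging to `F`. -/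
def Reorient {n : ℕ} (φ : CubeOrientation n) (F : Finset (Fin n)) : CubeOrientation n :=
  fun v i => if i ∈ F then φ (vflip v i) i else φ v i

/-- Strong Holt–Klee property. -/
def StronglyHoltKlee {n : ℕ} (φ : CubeOrientation n) : Prop :=
  ∀ F : Finset (Fin n), HoltKlee (Reorient φ F)

/-- A P-matrix: all principal minors are positive. -/
def IsPMatrix {n : ℕ} (M : Matrix (Fin n) (Fin n) ℝ) : Prop :=
  ∀ S : Finset (Fin n), S.Nonempty →
    0 < (M.submatrix (fun i : S => (i : Fin n)) (fun i : S => (i : Fin n))).det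

/-- A Z-matrix: all off-diagonal entries are non-positive. -/
def IsZMatrix {n : ℕ} (M : Matrix (Fin n) (Fin n) ℝ) : Prop :=
  ∀ i j, i ≠ j → M i j ≤ 0

/-- A K-matrix: both a Z-matrix and a P-matrix. -/
def IsKMatrix {n : ℕ} (M : Matrix (Fin n) (Fin n) ℝ) : Prop :=
  IsZMatrix M ∧ IsPMatrix M

/-- The matrix `A_B`: its `s`-th column is the `s`-th column of `-M` if `s ∈ B`,
and the `s`-th column of the identity matrix otherwise. -/
def ABmat {n : ℕ} (M : Matrix (Fin n) (Fin n) ℝ) (B : Finset (Fin n)) :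
    Matrix (Fin n) (Fin n) ℝ :=
  fun r s => if s ∈ B then -(M r s) else if r = s then 1 else 0

/-- The vector `A_B⁻¹ q`. -/
noncomputable def lcpVal {n : ℕ} (M : Matrix (Fin n) (Fin n) ℝ) (q : Fin n → ℝ)
    (B : Finset (Fin n)) : Fin n → ℝ :=
  (ABmat M B)⁻¹ *ᵥ q

/-- `q` is nondegenerate for `M`: `(A_B⁻¹ q)_i ≠ 0` for all `B` and `i`. -/
def Nondegenerate {n : ℕ} (M : Matrix (Fin n) (Fin n) ℝ) (q : Fin n → ℝ) : Prop :=
  ∀ (B : Finset (Fin n)) (i : Fin n), lcpVal M q B i ≠ 0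

/-- `B(v) = {j : v_j = 1}`. -/
def vertexBasis {n : ℕ} (v : Vertex n) : Finset (Fin n) :=
  Finset.univ.filter (fun j => v j = true)

/-- The orientation induced by `LCP(M, q)`: `v → v ⊕ i` iff `(A_{B(v)}⁻¹ q)_i < 0`. -/
noncomputable def inducedOrientation {n : ℕ} (M : Matrix (Fin n) (Fin n) ℝ)
    (q : Fin n → ℝ) : CubeOrientation n :=
  fun v i => decide (lcpVal M q (vertexBasis v) i < 0)

/-- A P-USO: an orientation induced by an LCP with a P-matrix and nondegenerate `q`. -/
def IsPUSO {n : ℕ} (φ : CubeOrientation n) : Prop :=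
  ∃ (M : Matrix (Fin n) (Fin n) ℝ) (q : Fin n → ℝ),
    IsPMatrix M ∧ Nondegenerate M q ∧ φ = inducedOrientation M q

/-- A K-USO: an orientation induced by an LCP with a K-matrix and nondegenerate `q`. -/
def IsKUSO {n : ℕ} (φ : CubeOrientation n) : Prop :=
  ∃ (M : Matrix (Fin n) (Fin n) ℝ) (q : Fin n → ℝ),
    IsKMatrix M ∧ Nondegenerate M q ∧ φ = inducedOrientation M q


/-- The matrix with unit diagonal whose only other nonzero entries are those of `T` in rows
`i ≥ m` and columns `j < m`. -/
def blockMatrix {n : ℕ} (m : ℕ) (T : Fin n → Fin n → ℝ) : Matrix (Fin n) (Fin n) ℝ :=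
  fun i j => if i = j then 1 else if (j : ℕ) < m ∧ m ≤ (i : ℕ) then T i j else 0

/-- The right-hand side with entries `-1` in rows `i < m` and `1 / 2` in rows `i ≥ m`. -/
noncomputable def blockVector (n m : ℕ) : Fin n → ℝ :=
  fun i => if (i : ℕ) < m then -1 else 1 / 2

lemma blockMatrix_isPMatrix {n : ℕ} (m : ℕ) (T : Fin n → Fin n → ℝ) :
    IsPMatrix (blockMatrix m T) := by
  intro S _
  rw [Matrix.det_of_isLowerTriangular]
  · simp [blockMatrix]
  · intro i j hij
    have hij' : (i : Fin n) < j := hij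
    have h1 : (i : Fin n) ≠ j := hij'.ne
    have h2 : ((i : Fin n) : ℕ) < ((j : Fin n) : ℕ) := hij'
    simp only [Matrix.submatrix_apply, blockMatrix, h1, if_false]
    rw [if_neg]
    omega

lemma isUnit_det_ABmat_blockMatrix {n : ℕ} (m : ℕ) (T : Fin n → Fin n → ℝ)
    (B : Finset (Fin n)) : IsUnit (ABmat (blockMatrix m T) B).det := by
  rw [Matrix.det_of_isLowerTriangular]
  · rw [isUnit_iff_ne_zero, Finset.prod_ne_zero_iff]
    intro i _
    simp only [ABmat, blockMatrix]
    split_ifs <;> simp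
  · intro i j hij
    have hij' : i < j := hij
    have h1 : i ≠ j := hij'.ne
    have h2 : (i : ℕ) < (j : ℕ) := hij'
    have h3 : ¬ ((j : ℕ) < m ∧ m ≤ (i : ℕ)) := by omega
    simp [ABmat, blockMatrix, h1, h3]

lemma lcpVal_blockMatrix {n : ℕ} (m : ℕ) (T : Fin n → Fin n → ℝ) (B : Finset (Fin n)) :
    lcpVal (blockMatrix m T) (blockVector n m) B = fun i =>
      (if i ∈ B then -1 else 1) *
        if (i : ℕ) < m then -1
        else 1 / 2 + ∑ j : Fin n, if j ∈ B ∧ (j : ℕ) < m then T i j else 0 := by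
  have hunit := isUnit_det_ABmat_blockMatrix m T B
  unfold lcpVal
  rw [← (Matrix.mulVec_injective_iff_isUnit.mpr
    ((Matrix.isUnit_iff_isUnit_det _).mpr hunit)).eq_iff, Matrix.mulVec_mulVec,
    Matrix.mul_nonsing_inv _ hunit, Matrix.one_mulVec]
  ext i
  rw [Matrix.mulVec, dotProduct, ← Finset.add_sum_erase _ _ (Finset.mem_univ i)]
  by_cases hi : (i : ℕ) < m
  · rw [Finset.sum_eq_zero (s := Finset.univ.erase i)]
    · by_cases hB : i ∈ B <;> simp [ABmat, blockMatrix, blockVector, hi, hB]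
    · intro j hj
      have hj : j ≠ i := Finset.ne_of_mem_erase hj
      simp [ABmat, blockMatrix, hj.symm, not_le.mpr hi]
  · rw [← Finset.add_sum_erase _ (fun j => if j ∈ B ∧ (j : ℕ) < m then T i j else 0)
      (Finset.mem_univ i)]
    have hsum : ∀ j ∈ Finset.univ.erase i, ABmat (blockMatrix m T) B i j *
        ((if j ∈ B then -1 else 1) *
          if (j : ℕ) < m then -1
          else 1 / 2 + ∑ l : Fin n, if l ∈ B ∧ (l : ℕ) < m then T j l else 0)
        = - if j ∈ B ∧ (j : ℕ) < m then T i j else 0 := by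
      intro j hj
      have hj : j ≠ i := Finset.ne_of_mem_erase hj
      by_cases hB : j ∈ B <;> by_cases hm : (j : ℕ) < m <;>
        simp [ABmat, blockMatrix, hj.symm, hB, hm, not_lt.mp hi]
    rw [Finset.sum_congr rfl hsum, Finset.sum_neg_distrib]
    by_cases hB : i ∈ B <;> simp [ABmat, blockMatrix, blockVector, hi, hB]

/-- Powers of two in columns `j < m`, the negated thresholds `c (i - 2 * m) (j - m)` elsewhere
(zero outside the range of `c`). -/
def thresholdWeights {m : ℕ} (c : Fin m → Fin m → Fin (2 ^ m)) (n : ℕ) (i j : Fin n) : ℤ :=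
  if (j : ℕ) < m then 2 ^ (j : ℕ)
  else if h : (i : ℕ) - 2 * m < m ∧ (j : ℕ) - m < m then
    -((c ⟨i - 2 * m, h.1⟩ ⟨j - m, h.2⟩ : ℕ) : ℤ)
  else 0

/-- The `P`-USO attached to a table of thresholds. -/
noncomputable def thresholdOrientation {m : ℕ} (c : Fin m → Fin m → Fin (2 ^ m)) (n : ℕ) :
    CubeOrientation n :=
  inducedOrientation (blockMatrix (2 * m) fun i j => (thresholdWeights c n i j : ℝ))
    (blockVector n (2 * m))

lemma half_add_intCast_neg_iff (z : ℤ) : (1 / 2 + (z : ℝ) < 0) ↔ z < 0 := by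
  constructor
  · intro h
    by_contra hz
    have : (0 : ℝ) ≤ z := by exact_mod_cast not_lt.mp hz
    linarith
  · intro h
    have : (z : ℝ) ≤ -1 := by exact_mod_cast (by omega : z ≤ -1)
    linarith

lemma half_add_intCast_ne_zero (z : ℤ) : (1 / 2 + (z : ℝ)) ≠ 0 := by
  intro h
  have h1 : ((1 + 2 * z : ℤ) : ℝ) = 0 := by push_cast; linarith
  have h2 : 1 + 2 * z = 0 := by exact_mod_cast h1
  omega

lemma sum_ite_intCast {ι : Type*} [Fintype ι] (p : ι → Prop) [DecidablePred p] (f : ι → ℤ) :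
    (∑ j, if p j then (f j : ℝ) else 0) = ((∑ j, if p j then f j else 0 : ℤ) : ℝ) := by
  push_cast
  rfl

lemma thresholdOrientation_isPUSO {m : ℕ} (c : Fin m → Fin m → Fin (2 ^ m)) (n : ℕ) :
    IsPUSO (thresholdOrientation c n) := by
  refine ⟨_, _, blockMatrix_isPMatrix _ _, ?_, rfl⟩
  intro B i
  rw [lcpVal_blockMatrix]
  refine mul_ne_zero (by split_ifs <;> norm_num) ?_
  split_ifs
  · norm_num
  · rw [sum_ite_intCast]
    exact half_add_intCast_ne_zero _

/-- The vertex whose first `m` bits are the binary digits of `x`, with the bit `m + j` also set. -/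
def thresholdVertex (n m x j : ℕ) : Vertex n :=
  fun i => ((i : ℕ) < m && x.testBit i) || (i : ℕ) == m + j

lemma sum_range_testBit (m x : ℕ) (hx : x < 2 ^ m) :
    ∑ i ∈ Finset.range m, (if x.testBit i then 2 ^ i else 0) = x := by
  induction m generalizing x with
  | zero => simp at hx; simp [hx]
  | succ m ih =>
    rw [Finset.sum_range_succ']
    have h := ih (x / 2) (by rw [pow_succ] at hx; omega)
    have h2 : ∑ i ∈ Finset.range m, (if x.testBit (i + 1) then 2 ^ (i + 1) else 0)
        = 2 * (x / 2) := by
      conv_rhs => rw [← h, Finset.mul_sum]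
      refine Finset.sum_congr rfl fun i _ => ?_
      rw [Nat.testBit_succ]
      split_ifs <;> ring
    rw [h2, Nat.testBit_zero]
    rcases Nat.mod_two_eq_zero_or_one x with h0 | h0 <;> simp [h0] <;> omega

lemma thresholdOrientation_apply {m n : ℕ} (hn : 3 * m ≤ n) (c : Fin m → Fin m → Fin (2 ^ m))
    (r j : Fin m) (x : ℕ) (hx : x < 2 ^ m) :
    thresholdOrientation c n (thresholdVertex n m x j) ⟨2 * m + r, by omega⟩ =
      decide (x < (c r j : ℕ)) := by
  unfold thresholdOrientation inducedOrientation
  rw [lcpVal_blockMatrix]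
  have hnot : (⟨2 * m + r, by omega⟩ : Fin n) ∉ vertexBasis (thresholdVertex n m x j) := by
    simp [vertexBasis, thresholdVertex]
    omega
  simp only [hnot, if_false, one_mul, show ¬ (2 * m + (r : ℕ) < 2 * m) by omega, sum_ite_intCast,
    half_add_intCast_neg_iff]
  congr 1
  have key : (∑ l : Fin n, if l ∈ vertexBasis (thresholdVertex n m x j) ∧ (l : ℕ) < 2 * m then
      thresholdWeights c n ⟨2 * m + r, by omega⟩ l else 0) = (x : ℤ) - (c r j : ℕ) := by
    have hterm : ∀ l : Fin n,
        (if l ∈ vertexBasis (thresholdVertex n m x j) ∧ (l : ℕ) < 2 * m then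
          thresholdWeights c n ⟨2 * m + r, by omega⟩ l else 0) =
        (fun k : ℕ => ((if k < m then (if x.testBit k then 2 ^ k else 0) else 0 : ℕ) : ℤ)
          - if k = m + j then ((c r j : ℕ) : ℤ) else 0) (l : ℕ) := by
      intro l
      simp only [vertexBasis, thresholdVertex, thresholdWeights]
      by_cases h1 : (l : ℕ) < m
      · have h2 : (l : ℕ) ≠ m + j := by omega
        have h3 : (l : ℕ) < 2 * m := by omega
        by_cases h4 : x.testBit l <;> simp [h1, h2, h3, h4]
      · by_cases h2 : (l : ℕ) = m + j
        · have h3 : m + (j : ℕ) < 2 * m := by omega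
          simp [h2, h3]
        · simp [h1, h2]
    rw [Finset.sum_congr rfl fun l _ => hterm l, Fin.sum_univ_eq_sum_range (n := n)
      (fun k : ℕ => ((if k < m then (if x.testBit k then 2 ^ k else 0) else 0 : ℕ) : ℤ)
          - if k = m + j then ((c r j : ℕ) : ℤ) else 0), Finset.sum_sub_distrib]
    congr 1
    · rw [← Nat.cast_sum, ← Finset.sum_filter]
      have : (Finset.range n).filter (· < m) = Finset.range m := by
        ext; simp; omega
      rw [this, sum_range_testBit m x hx]
    · rw [Finset.sum_ite_eq', if_pos]
      simp; omega
  rw [key]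
  simp

lemma thresholdOrientation_injective {m n : ℕ} (hn : 3 * m ≤ n) :
    Function.Injective fun c : Fin m → Fin m → Fin (2 ^ m) => thresholdOrientation c n := by
  intro c d hcd
  funext r j
  have h : ∀ x < 2 ^ m, (x < (c r j : ℕ) ↔ x < (d r j : ℕ)) := by
    intro x hx
    have h1 := thresholdOrientation_apply hn c r j x hx
    have h2 := thresholdOrientation_apply hn d r j x hx
    simp only at hcd
    rw [hcd, h2] at h1
    simpa using h1.symm
  apply Fin.ext
  have hc := h _ (c r j).isLt
  have hd := h _ (d r j).isLt
  omega

theorem two_pow_le_card_PUSO {m n : ℕ} (hn : 3 * m ≤ n) :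
    2 ^ m ^ 3 ≤ Nat.card {φ : CubeOrientation n // IsPUSO φ} := by
  have h := Nat.card_le_card_of_injective
    (fun c : Fin m → Fin m → Fin (2 ^ m) =>
      (⟨thresholdOrientation c n, thresholdOrientation_isPUSO c n⟩ :
        {φ : CubeOrientation n // IsPUSO φ}))
    (fun c d hcd => thresholdOrientation_injective hn (congrArg Subtype.val hcd))
  refine le_trans (le_of_eq ?_) h
  simp [← pow_mul]
  ring


open MvPolynomial in
lemma hasDerivAt_eval_update {σ : Type*} [DecidableEq σ] (x : σ → ℝ) (j : σ)
    (p : MvPolynomial σ ℝ) (t : ℝ) :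
    HasDerivAt (fun s => eval (Function.update x j s) p)
      (eval (Function.update x j t) (pderiv j p)) t := by
  induction p using MvPolynomial.induction_on with
  | C r => simpa using hasDerivAt_const t r
  | add p q hp hq => 
    simp only [map_add]
    exact hp.add hq
  | mul_X p i hp =>
    have hX : HasDerivAt (fun s => Function.update x j s i)
        (eval (Function.update x j t) (pderiv j (X i : MvPolynomial σ ℝ))) t := by
      by_cases h : i = j
      · subst h
        simp only [Function.update_self, pderiv_X_self, map_one]
        exact hasDerivAt_id t
      · simpa [h, pderiv_X, Pi.single_apply] using hasDerivAt_const t (x i)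
    have := hp.mul hX
    simp only [map_mul, eval_X, Derivation.leibniz, smul_eq_mul, map_add] at this ⊢
    rw [add_comm, mul_comm (Function.update x j t i)]
    exact this

open MvPolynomial in
/-- On a bounded component of the complement of the zero set of `F`, the logarithmic gradient
of `F` takes every value. -/
lemma exists_logGradient_eq {σ : Type*} [Fintype σ] [DecidableEq σ] {F : MvPolynomial σ ℝ}
    {K U : Set (σ → ℝ)} (hK : IsCompact K) (hU : IsOpen U) (hUK : U ⊆ K)
    (hne : ∃ x ∈ U, eval x F ≠ 0) (hbd : ∀ x ∈ K, eval x F ≠ 0 → x ∈ U) (a : σ → ℝ) :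
    ∃ x ∈ U, eval x F ≠ 0 ∧ ∀ j, eval x (pderiv j F) = a j * eval x F := by
  let E : MvPolynomial σ ℝ := ∑ i, C (-(2 * a i)) * X i
  let G : (σ → ℝ) → ℝ := fun y => eval y F ^ 2 * Real.exp (eval y E)
  have hG : Continuous G :=
    ((MvPolynomial.continuous_eval F).pow 2).mul
      (Real.continuous_exp.comp (MvPolynomial.continuous_eval E))
  obtain ⟨x₀, hx₀, hFx₀⟩ := hne
  obtain ⟨x, hxK, hmax⟩ := hK.exists_isMaxOn ⟨x₀, hUK hx₀⟩ hG.continuousOn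
  have hpos : 0 < G x := lt_of_lt_of_le (by positivity) (hmax (hUK hx₀))
  have hFx : eval x F ≠ 0 := by
    intro h
    simp [G, h] at hpos
  have hxU := hbd x hxK hFx
  refine ⟨x, hxU, hFx, fun j => ?_⟩
  have hloc : IsLocalMax G x := hmax.isLocalMax (Filter.mem_of_superset (hU.mem_nhds hxU) hUK)
  have hline : IsLocalMax (fun t => G (Function.update x j t)) (x j) := by
    have hc : ContinuousAt (fun t => Function.update x j t) (x j) :=
      (continuous_const.update j continuous_id).continuousAt
    have hloc' : IsLocalMax G (Function.update x j (x j)) := by simpa using hloc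
    exact hc.eventually hloc'
  have hF := hasDerivAt_eval_update x j F (x j)
  have hE := hasDerivAt_eval_update x j E (x j)
  have hder := hline.hasDerivAt_eq_zero ((hF.pow 2).mul hE.exp)
  have hEj : eval x (pderiv j E) = -(2 * a j) := by
    simp [E, pderiv_X, Pi.single_apply]
  rw [Function.update_eq_self, hEj] at hder
  have hexp := Real.exp_ne_zero (eval x E)
  have : 2 * eval x F * Real.exp (eval x E) * (eval x (pderiv j F) - a j * eval x F) = 0 := by
    rw [← hder]
    simp
    ring
  have h0 : 2 * eval x F * Real.exp (eval x E) ≠ 0 := by positivity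
  exact sub_eq_zero.mp ((mul_eq_zero.mp this).resolve_left h0)

lemma finrank_restrictDegree {σ : Type*} [Fintype σ] (T : ℕ) :
    Module.finrank ℝ (MvPolynomial.restrictDegree σ ℝ T) = (T + 1) ^ Fintype.card σ := by
  classical
  have e : {s : σ →₀ ℕ | ∀ i, s i ≤ T} ≃ (σ → Fin (T + 1)) :=
    { toFun := fun s i => ⟨s.1 i, Nat.lt_succ_of_le (s.2 i)⟩
      invFun := fun s => ⟨Finsupp.equivFunOnFinite.symm fun i => s i,
        fun i => by simpa using Nat.le_of_lt_succ (s i).isLt⟩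
      left_inv := fun s => by ext; simp
      right_inv := fun s => by ext; simp }
  have h := Module.finrank_eq_nat_card_basis
    (MvPolynomial.basisRestrictSupport ℝ {s : σ →₀ ℕ | ∀ i, s i ≤ T})
  rw [Nat.card_congr e] at h
  
  rw [MvPolynomial.restrictDegree, h]
  simp

open MvPolynomial in
lemma totalDegree_pderiv_le {σ : Type*} (j : σ) (p : MvPolynomial σ ℝ) :
    (pderiv j p).totalDegree ≤ p.totalDegree := by
  classical
  conv_lhs => rw [p.as_sum, map_sum]
  refine totalDegree_finsetSum_le fun s hs => ?_
  rw [pderiv_monomial]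
  refine (totalDegree_monomial_le _ _).trans (le_trans ?_ (le_totalDegree hs))
  exact Finsupp.degree_mono (tsub_le_self)

open MvPolynomial in
/-- A linear form satisfies a polynomial equation of bounded degree over the partial logarithmic
derivatives of `F`. -/
lemma exists_algebraic_relation {σ : Type*} [Fintype σ] {F ℓ : MvPolynomial σ ℝ} {D : ℕ}
    (hF : F.totalDegree ≤ D) (hℓ : ℓ.totalDegree ≤ 1) :
    ∃ Q : Polynomial (MvPolynomial σ ℝ), Q ≠ 0 ∧
      Q.natDegree ≤ (Fintype.card σ * D + 1) ^ Fintype.card σ ∧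
      ∀ x a : σ → ℝ, eval x F ≠ 0 → (∀ j, eval x (pderiv j F) = a j * eval x F) →
        (Q.map (eval a)).eval (eval x ℓ) = 0 := by
  classical
  set k := Fintype.card σ with hk
  set m := (k * D + 1) ^ k + 1 with hm
  have hm0 : 0 < m := by omega
  let p : (σ → Fin m) × Fin m → MvPolynomial σ ℝ := fun α =>
    (∏ j, F ^ (m - (α.1 j : ℕ)) * pderiv j F ^ (α.1 j : ℕ)) * ℓ ^ (α.2 : ℕ)
  have hdeg : ∀ α, (p α).totalDegree ≤ k * (m * D) + (m - 1) := by
    intro α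
    refine (totalDegree_mul _ _).trans (add_le_add ?_ ?_)
    · refine (totalDegree_finsetProd _ _).trans ?_
      rw [hk, Fintype.card, ← smul_eq_mul, ← Finset.sum_const]
      refine Finset.sum_le_sum fun j _ => ?_
      refine (totalDegree_mul _ _).trans ?_
      have h1 := totalDegree_pow F (m - (α.1 j : ℕ))
      have h2 := totalDegree_pow (pderiv j F) (α.1 j : ℕ)
      have h3 := (totalDegree_pderiv_le j F).trans hF
      have h4 := Nat.mul_le_mul_left (m - (α.1 j : ℕ)) hF
      have h5 := Nat.mul_le_mul_left (α.1 j : ℕ) h3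
      calc _ ≤ (m - (α.1 j : ℕ)) * D + (α.1 j : ℕ) * D := add_le_add (h1.trans h4) (h2.trans h5)
        _ = m * D := by
          rw [← add_mul, Nat.sub_add_cancel (α.1 j).isLt.le]
    · have h1 := totalDegree_pow ℓ (α.2 : ℕ)
      have h2 := Nat.mul_le_mul_left (α.2 : ℕ) hℓ
      omega
  let V := restrictDegree σ ℝ (k * (m * D) + (m - 1))
  let w : (σ → Fin m) × Fin m → V := fun α =>
    ⟨p α, restrictTotalDegree_le_restrictDegree _ _ _ ((mem_restrictTotalDegree _ _ _).mpr (hdeg α))⟩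
  have hdep : ¬ LinearIndependent ℝ w := by
    intro hli
    have h1 := hli.fintype_card_le_finrank
    rw [finrank_restrictDegree] at h1
    have h2 : k * (m * D) + (m - 1) + 1 = m * (k * D + 1) := by
      rw [add_assoc, Nat.sub_add_cancel hm0]
      ring
    rw [h2, ← hk, mul_pow] at h1
    simp only [Fintype.card_prod, Fintype.card_fun, Fintype.card_fin, ← hk] at h1
    have h3 := Nat.le_of_mul_le_mul_left h1 (by positivity)
    omega
  obtain ⟨c, hc, α₀, hα₀⟩ := Fintype.not_linearIndependent_iff.mp hdep
  have hc' : ∑ α, c α • p α = 0 := by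
    have := congrArg Subtype.val hc
    simpa [w] using this
  let em : (σ → Fin m) → (σ →₀ ℕ) := fun α => Finsupp.equivFunOnFinite.symm fun i => (α i : ℕ)
  have hem : Function.Injective em := by
    intro α β h
    funext i
    have := DFunLike.congr_fun h i
    exact Fin.ext (by simpa [em] using this)
  let Q : Polynomial (MvPolynomial σ ℝ) :=
    ∑ α : (σ → Fin m) × Fin m, Polynomial.monomial (α.2 : ℕ) (monomial (em α.1) (c α))
  refine ⟨Q, ?_, ?_, ?_⟩
  · intro hQ
    apply hα₀
    have h1 : coeff (em α₀.1) (Q.coeff (α₀.2 : ℕ)) = c α₀ := by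
      simp only [Q, Polynomial.finsetSum_coeff, Polynomial.coeff_monomial, coeff_sum]
      rw [Finset.sum_eq_single α₀]
      · simp
      · intro β _ hβ
        split_ifs with h
        · rw [coeff_monomial, if_neg]
          intro h'
          exact hβ (Prod.ext (hem h') (Fin.ext h))
        · simp
      · simp
    rw [← h1, hQ]
    simp
  · refine Polynomial.natDegree_sum_le_of_forall_le _ _ fun α _ => ?_
    refine (Polynomial.natDegree_monomial_le _).trans ?_
    have := α.2.isLt
    omega
  · intro x a hx ha
    have h1 := congrArg (eval x) hc'
    have h2 : ∀ α, eval x (c α • p α) = (eval x F ^ m) ^ k *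
        (c α * (∏ j, a j ^ (α.1 j : ℕ)) * eval x ℓ ^ (α.2 : ℕ)) := by
      intro α
      have h3 : ∏ j, eval x (F ^ (m - (α.1 j : ℕ)) * pderiv j F ^ (α.1 j : ℕ))
          = (eval x F ^ m) ^ k * ∏ j, a j ^ (α.1 j : ℕ) := by
        rw [hk, Fintype.card, ← Finset.prod_const, ← Finset.prod_mul_distrib]
        refine Finset.prod_congr rfl fun j _ => ?_
        rw [map_mul, map_pow, map_pow, ha, mul_pow, mul_left_comm, ← pow_add,
          Nat.sub_add_cancel (α.1 j).isLt.le, mul_comm]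
      simp only [p, smul_eval, map_mul, map_prod, map_pow] at h3 ⊢
      rw [h3]
      ring
    rw [map_sum, Finset.sum_congr rfl fun α _ => h2 α, ← Finset.mul_sum, map_zero] at h1
    have h4 := (mul_eq_zero.mp h1).resolve_left (by positivity)
    rw [← h4]
    simp only [Q, Polynomial.map_sum, Polynomial.map_monomial, Polynomial.eval_finsetSum,
      Polynomial.eval_monomial, eval_monomial]
    refine Finset.sum_congr rfl fun α _ => ?_
    rw [Finsupp.prod_fintype _ _ (by simp)]
    simp [em]

open MvPolynomial in
/-- Countably many nonzero real polynomials have a common nonvanishing point. -/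
lemma exists_forall_eval_ne_zero {σ : Type*} [Fintype σ] (p : ℕ → MvPolynomial σ ℝ)
    (hp : ∀ u, p u ≠ 0) : ∃ a : σ → ℝ, ∀ u, eval a (p u) ≠ 0 := by
  have hopen : ∀ u, IsOpen {a : σ → ℝ | eval a (p u) ≠ 0} := fun u =>
    isOpen_ne_fun (MvPolynomial.continuous_eval _) continuous_const
  have hdense : ∀ u, Dense {a : σ → ℝ | eval a (p u) ≠ 0} := by
    intro u
    rw [dense_iff_inter_open]
    intro V hV ⟨y, hy⟩
    by_contra hempty
    obtain ⟨ε, hε, hball⟩ := Metric.isOpen_iff.mp hV y hy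
    apply hp u
    refine funext_set (fun i => Metric.ball (y i) ε) (fun i => ?_) fun z hz => ?_
    · rw [Real.ball_eq_Ioo]
      exact Set.Ioo_infinite (by linarith)
    · have hzV : z ∈ V := hball ((ball_pi y hε).symm ▸ hz)
      by_contra h
      exact hempty ⟨z, hzV, by simpa using h⟩
  obtain ⟨a, ha⟩ := (dense_iInter_of_isOpen_nat hopen hdense).nonempty
  exact ⟨a, fun u => Set.mem_iInter.mp ha u⟩

open MvPolynomial in
/-- Finitely many points are separated by some linear form `∑ uⁱ xᵢ` with `u` a natural number. -/
lemma exists_separating_form {σ T : Type*} [Fintype σ] [Finite T] (e : σ → ℕ)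
    (he : Function.Injective e) (x : T → σ → ℝ) (hx : Function.Injective x) :
    ∃ u : ℕ, Function.Injective fun τ => ∑ i, (u : ℝ) ^ e i * x τ i := by
  classical
  let P : T × T → Polynomial ℝ := fun τ =>
    ∑ i, Polynomial.monomial (e i) (x τ.1 i - x τ.2 i)
  have hP : ∀ τ : T × T, τ.1 ≠ τ.2 → P τ ≠ 0 := by
    intro τ hτ h
    apply hτ
    apply hx
    funext i
    have h1 : (P τ).coeff (e i) = x τ.1 i - x τ.2 i := by
      simp [P, Polynomial.finsetSum_coeff, Polynomial.coeff_monomial, he.eq_iff]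
    rw [h] at h1
    simp at h1
    linarith
  have hfin : (⋃ τ ∈ {τ : T × T | τ.1 ≠ τ.2}, {r : ℝ | (P τ).IsRoot r}).Finite :=
    (Set.toFinite _).biUnion fun τ hτ => Polynomial.finite_setOfPred_isRoot (hP τ hτ)
  have hinf : (Set.range fun u : ℕ => (u : ℝ)).Infinite :=
    Set.infinite_range_of_injective Nat.cast_injective
  obtain ⟨_, ⟨u, rfl⟩, hu⟩ := hinf.exists_notMem_finite hfin
  refine ⟨u, fun τ τ' h => ?_⟩
  by_contra hne
  apply hu
  refine Set.mem_biUnion (x := (τ, τ')) hne ?_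
  simp only at h
  simp only [P, Set.mem_ofPred_eq, Polynomial.IsRoot, Polynomial.eval_finsetSum,
    Polynomial.eval_monomial, sub_mul, Finset.sum_sub_distrib]
  rw [sub_eq_zero]
  simpa only [mul_comm] using h

open MvPolynomial in
theorem card_le_of_disjoint_components {σ T : Type*} [Fintype σ] [Finite T]
    {F : MvPolynomial σ ℝ} {D : ℕ} (hF : F.totalDegree ≤ D) (K U : T → Set (σ → ℝ))
    (hK : ∀ τ, IsCompact (K τ)) (hU : ∀ τ, IsOpen (U τ)) (hUK : ∀ τ, U τ ⊆ K τ)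
    (hne : ∀ τ, ∃ x ∈ U τ, eval x F ≠ 0) (hbd : ∀ τ, ∀ x ∈ K τ, eval x F ≠ 0 → x ∈ U τ)
    (hdisj : ∀ τ τ' x, x ∈ U τ → x ∈ U τ' → τ = τ') :
    Nat.card T ≤ (Fintype.card σ * D + 1) ^ Fintype.card σ := by
  classical
  let e : σ → ℕ := fun i => Fintype.equivFin σ i
  have he : Function.Injective e := Fin.val_injective.comp (Fintype.equivFin σ).injective
  let ℓ : ℕ → MvPolynomial σ ℝ := fun u => ∑ i, C ((u : ℝ) ^ e i) * X i
  have hℓ : ∀ u, (ℓ u).totalDegree ≤ 1 := by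
    intro u
    refine totalDegree_finsetSum_le fun i _ => ?_
    refine (totalDegree_mul _ _).trans ?_
    rw [totalDegree_C, totalDegree_X]
  choose Q hQ0 hQdeg hQ using fun u => exists_algebraic_relation hF (hℓ u)
  obtain ⟨a, ha⟩ := exists_forall_eval_ne_zero (fun u => (Q u).leadingCoeff)
    fun u => Polynomial.leadingCoeff_ne_zero.mpr (hQ0 u)
  choose x hxU hx0 hxa using fun τ =>
    exists_logGradient_eq (hK τ) (hU τ) (hUK τ) (hne τ) (hbd τ) a
  have hxinj : Function.Injective x := fun τ τ' h => hdisj τ τ' (x τ) (hxU τ) (h ▸ hxU τ')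
  obtain ⟨u, hu⟩ := exists_separating_form e he x hxinj
  have hmap : (Q u).map (eval a) ≠ 0 := by
    intro h
    apply ha u
    have := congrArg (fun q => q.coeff (Q u).natDegree) h
    simpa using this
  have hroot : ∀ τ, ∑ i, (u : ℝ) ^ e i * x τ i ∈ ((Q u).map (eval a)).roots.toFinset := by
    intro τ
    rw [Multiset.mem_toFinset, Polynomial.mem_roots hmap, Polynomial.IsRoot]
    have := hQ u (x τ) a (hx0 τ) (hxa τ)
    simpa [ℓ] using this
  have hcard := Nat.card_le_card_of_injective
    (fun τ => (⟨_, hroot τ⟩ : ((Q u).map (eval a)).roots.toFinset))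
    (fun τ τ' h => hu (congrArg Subtype.val h))
  rw [Nat.card_eq_fintype_card (α := ((Q u).map (eval a)).roots.toFinset),
    Fintype.card_coe] at hcard
  exact hcard.trans ((Multiset.toFinset_card_le _).trans
    ((Polynomial.card_roots' _).trans (Polynomial.natDegree_map_le.trans (hQdeg u))))

open MvPolynomial in
/-- A bound on the number of sign patterns without zeros of a finite family of polynomials. -/
theorem card_signPatterns_le {σ ι : Type*} [Fintype σ] [Fintype ι] {d : ℕ}
    (f : ι → MvPolynomial σ ℝ) (hf : ∀ i, (f i).totalDegree ≤ d) :
    Nat.card {τ : ι → Bool // ∃ x, ∀ i, eval x (f i) ≠ 0 ∧ (τ i = true ↔ eval x (f i) < 0)} ≤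
      (Fintype.card σ * (Fintype.card ι * d + 2) + 1) ^ Fintype.card σ := by
  classical
  set S := {τ : ι → Bool // ∃ x, ∀ i, eval x (f i) ≠ 0 ∧ (τ i = true ↔ eval x (f i) < 0)}
  choose x hx using fun τ : S => τ.2
  obtain ⟨R, hR⟩ : ∃ R : ℝ, ∀ τ : S, ∑ j, x τ j ^ 2 < R := by
    obtain ⟨R, hR⟩ := (Set.finite_range fun τ : S => ∑ j, x τ j ^ 2).bddAbove
    exact ⟨R + 1, fun τ => lt_of_le_of_lt (hR ⟨τ, rfl⟩) (lt_add_one R)⟩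
  let b : MvPolynomial σ ℝ := C R - ∑ j, X j ^ 2
  have hb : ∀ y, eval y b = R - ∑ j, y j ^ 2 := fun y => by simp [b]
  let s : S → ι → ℝ := fun τ i => if τ.1 i then -1 else 1
  have hs : ∀ τ i, s τ i ≠ 0 := by
    intro τ i
    simp only [s]
    split_ifs <;> norm_num
  have hF : ((∏ i, f i) * b).totalDegree ≤ Fintype.card ι * d + 2 := by
    refine (totalDegree_mul _ _).trans (add_le_add ?_ ?_)
    · refine (totalDegree_finsetProd _ _).trans ?_
      rw [Fintype.card, ← smul_eq_mul, ← Finset.sum_const]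
      exact Finset.sum_le_sum fun i _ => hf i
    · refine (totalDegree_sub _ _).trans (max_le (by simp) ?_)
      refine totalDegree_finsetSum_le fun j _ => ?_
      refine (totalDegree_pow _ _).trans ?_
      rw [totalDegree_X]
  refine card_le_of_disjoint_components hF
    (fun τ => {y | (∀ i, 0 ≤ s τ i * eval y (f i)) ∧ 0 ≤ eval y b})
    (fun τ => {y | (∀ i, 0 < s τ i * eval y (f i)) ∧ 0 < eval y b}) ?_ ?_ ?_ ?_ ?_ ?_
  · intro τ
    refine Metric.isCompact_of_isClosed_isBounded ?_ ?_
    · refine IsClosed.inter (s₁ := {y | ∀ i, 0 ≤ s τ i * eval y (f i)}) ?_ ?_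
      · have : {y : σ → ℝ | ∀ i, 0 ≤ s τ i * eval y (f i)} =
            ⋂ i, {y | 0 ≤ s τ i * eval y (f i)} := by ext; simp
        rw [this]
        exact isClosed_iInter fun i => isClosed_le continuous_const
          (continuous_const.mul (MvPolynomial.continuous_eval _))
      · exact isClosed_le continuous_const (MvPolynomial.continuous_eval _)
    · refine (Metric.isBounded_closedBall (x := (0 : σ → ℝ)) (r := R + 1)).subset ?_
      rintro y ⟨_, hy⟩
      rw [hb] at hy
      have hsq : 0 ≤ ∑ j, y j ^ 2 := Finset.sum_nonneg fun j _ => sq_nonneg _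
      rw [mem_closedBall_zero_iff, pi_norm_le_iff_of_nonneg (by linarith)]
      intro j
      have h1 : y j ^ 2 ≤ ∑ j, y j ^ 2 :=
        Finset.single_le_sum (f := fun j => y j ^ 2) (fun j _ => sq_nonneg _) (Finset.mem_univ j)
      rw [Real.norm_eq_abs, abs_le]
      constructor <;> nlinarith
  · intro τ
    refine IsOpen.inter (s := {y | ∀ i, 0 < s τ i * eval y (f i)}) ?_ ?_
    · have : {y : σ → ℝ | ∀ i, 0 < s τ i * eval y (f i)} =
          ⋂ i, {y | 0 < s τ i * eval y (f i)} := by ext; simp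
      rw [this]
      exact isOpen_iInter_of_finite fun i => isOpen_lt continuous_const
        (continuous_const.mul (MvPolynomial.continuous_eval _))
    · exact isOpen_lt continuous_const (MvPolynomial.continuous_eval _)
  · exact fun τ y hy => ⟨fun i => (hy.1 i).le, hy.2.le⟩
  · intro τ
    have hbx : 0 < eval (x τ) b := by
      rw [hb]
      linarith [hR τ]
    refine ⟨x τ, ⟨fun i => ?_, hbx⟩, ?_⟩
    · obtain ⟨h0, h1⟩ := hx τ i
      by_cases h : τ.1 i = true
      · have := h1.mp h
        simp only [s, h, if_true]
        linarith
      · have := lt_of_le_of_ne (not_lt.mp (mt h1.mpr h)) h0.symm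
        simp only [s, h]
        simpa using this
    · rw [map_mul, map_prod]
      exact mul_ne_zero (Finset.prod_ne_zero_iff.mpr fun i _ => (hx τ i).1) hbx.ne'
  · rintro τ y ⟨h1, h2⟩ hy
    rw [map_mul, map_prod, mul_ne_zero_iff, Finset.prod_ne_zero_iff] at hy
    exact ⟨fun i => lt_of_le_of_ne (h1 i) (mul_ne_zero (hs τ i) (hy.1 i (Finset.mem_univ i))).symm,
      lt_of_le_of_ne h2 hy.2.symm⟩
  · rintro τ τ' y ⟨h1, _⟩ ⟨h2, _⟩
    apply Subtype.ext
    funext i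
    have h1 := h1 i
    have h2 := h2 i
    simp only [s] at h1 h2
    cases hτ : τ.1 i <;> cases hτ' : τ'.1 i <;> simp [hτ, hτ'] at h1 h2 ⊢ <;> linarith

open MvPolynomial in
lemma totalDegree_det_le {σ : Type*} {n : ℕ} (A : Matrix (Fin n) (Fin n) (MvPolynomial σ ℝ))
    (hA : ∀ i j, (A i j).totalDegree ≤ 1) : A.det.totalDegree ≤ n := by
  rw [Matrix.det_apply]
  refine totalDegree_finsetSum_le fun π _ => ?_
  refine (totalDegree_smul_le _ _).trans ?_
  refine (totalDegree_finsetProd _ _).trans ?_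
  refine (Finset.sum_le_sum fun i _ => hA _ _).trans ?_
  simp

/-- The matrix `A_B` with the entries of `M` as variables. -/
noncomputable def polyABmat {n : ℕ} (B : Finset (Fin n)) :
    Matrix (Fin n) (Fin n) (MvPolynomial ((Fin n × Fin n) ⊕ Fin n) ℝ) :=
  fun r s => if s ∈ B then -(MvPolynomial.X (Sum.inl (r, s))) else if r = s then 1 else 0

/-- A polynomial in the entries of `M` and `q` with the sign of `(A_B⁻¹ q)_i`. -/
noncomputable def lcpPoly {n : ℕ} (B : Finset (Fin n)) (i : Fin n) :
    MvPolynomial ((Fin n × Fin n) ⊕ Fin n) ℝ :=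
  (polyABmat B).det * ((polyABmat B).updateCol i fun j => MvPolynomial.X (Sum.inr j)).det

lemma totalDegree_polyABmat_le {n : ℕ} (B : Finset (Fin n)) (r s : Fin n) :
    (polyABmat B r s).totalDegree ≤ 1 := by
  unfold polyABmat
  split_ifs
  · rw [MvPolynomial.totalDegree_neg, MvPolynomial.totalDegree_X]
  · simp
  · simp

lemma totalDegree_lcpPoly_le {n : ℕ} (B : Finset (Fin n)) (i : Fin n) :
    (lcpPoly B i).totalDegree ≤ n + n := by
  refine (MvPolynomial.totalDegree_mul _ _).trans (add_le_add ?_ ?_)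
  · exact totalDegree_det_le _ (totalDegree_polyABmat_le B)
  · refine totalDegree_det_le _ fun r s => ?_
    rw [Matrix.updateCol_apply]
    split_ifs
    · rw [MvPolynomial.totalDegree_X]
    · exact totalDegree_polyABmat_le B r s

lemma eval_lcpPoly {n : ℕ} (M : Matrix (Fin n) (Fin n) ℝ) (q : Fin n → ℝ)
    (B : Finset (Fin n)) (i : Fin n) :
    MvPolynomial.eval (Sum.elim (fun p => M p.1 p.2) q) (lcpPoly B i) =
      (ABmat M B).det * (ABmat M B).cramer q i := by
  have hmap : (MvPolynomial.eval (Sum.elim (fun p => M p.1 p.2) q)).mapMatrix (polyABmat B) =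
      ABmat M B := by
    ext r s
    simp only [RingHom.mapMatrix_apply, Matrix.map_apply, polyABmat, ABmat]
    split_ifs <;> simp
  rw [lcpPoly, map_mul, RingHom.map_det, RingHom.map_det, hmap, Matrix.cramer_apply]
  congr 2
  rw [← hmap]
  ext r s
  simp only [RingHom.mapMatrix_apply, Matrix.map_apply, Matrix.updateCol_apply]
  split_ifs <;> simp

lemma sign_eval_lcpPoly {n : ℕ} {M : Matrix (Fin n) (Fin n) ℝ} {q : Fin n → ℝ}
    (B : Finset (Fin n)) (i : Fin n) (h : lcpVal M q B i ≠ 0) :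
    MvPolynomial.eval (Sum.elim (fun p => M p.1 p.2) q) (lcpPoly B i) ≠ 0 ∧
      (MvPolynomial.eval (Sum.elim (fun p => M p.1 p.2) q) (lcpPoly B i) < 0 ↔
        lcpVal M q B i < 0) := by
  have hval : lcpVal M q B i = ((ABmat M B).det)⁻¹ * (ABmat M B).cramer q i := by
    rw [lcpVal, Matrix.inv_def, Matrix.cramer_eq_adjugate_mulVec, Ring.inverse_eq_inv',
      Matrix.smul_mulVec, Pi.smul_apply, smul_eq_mul]
  have hdet : (ABmat M B).det ≠ 0 := by
    intro h0
    simp [hval, h0] at h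
  have heq : (ABmat M B).det * (ABmat M B).cramer q i =
      (ABmat M B).det ^ 2 * lcpVal M q B i := by
    rw [hval]
    field_simp
  have hpos : 0 < (ABmat M B).det ^ 2 := by positivity
  rw [eval_lcpPoly, heq]
  exact ⟨mul_ne_zero hpos.ne' h, ⟨fun h' => (pos_iff_neg_of_mul_neg h').mp hpos, mul_neg_of_pos_of_neg hpos⟩⟩

theorem card_PUSO_le_pow (n : ℕ) : Nat.card {φ : CubeOrientation n // IsPUSO φ} ≤
    ((n * n + n) * (2 ^ n * n * (n + n) + 2) + 1) ^ (n * n + n) := by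
  have hbound := card_signPatterns_le (fun p : Finset (Fin n) × Fin n => lcpPoly p.1 p.2)
    (fun p => totalDegree_lcpPoly_le p.1 p.2)
  simp only [Fintype.card_sum, Fintype.card_prod, Fintype.card_fin, Fintype.card_finset] at hbound
  refine le_trans ?_ hbound
  have hbasis : ∀ B : Finset (Fin n), vertexBasis (fun j => decide (j ∈ B)) = B := by
    intro B
    ext j
    simp [vertexBasis]
  refine Nat.card_le_card_of_injective (fun φ =>
    ⟨fun p => φ.1 (fun j => decide (j ∈ p.1)) p.2, ?_⟩) ?_
  · obtain ⟨φ, M, q, _, hq, rfl⟩ := φ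
    refine ⟨Sum.elim (fun p => M p.1 p.2) q, fun p => ?_⟩
    obtain ⟨h1, h2⟩ := sign_eval_lcpPoly p.1 p.2 (hq p.1 p.2)
    refine ⟨h1, ?_⟩
    rw [h2]
    simp [inducedOrientation, hbasis]
  · intro φ ψ h
    apply Subtype.ext
    funext v i
    have := congrFun (congrArg Subtype.val h) (vertexBasis v, i)
    simpa [vertexBasis] using this

theorem card_PUSO_le {n : ℕ} (hn : 1 ≤ n) :
    Nat.card {φ : CubeOrientation n // IsPUSO φ} ≤ 2 ^ (18 * n ^ 3) := by
  refine (card_PUSO_le_pow n).trans ?_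
  have h2 : n ≤ 2 ^ n := Nat.lt_two_pow_self.le
  have hbase : (n * n + n) * (2 ^ n * n * (n + n) + 2) + 1 ≤ 2 ^ (9 * n) := by
    have h1 : 1 ≤ 2 ^ n := Nat.one_le_two_pow
    have h16 : 16 ≤ 2 ^ (4 * n) := by
      calc 16 = 2 ^ (4 * 1) := by norm_num
        _ ≤ 2 ^ (4 * n) := Nat.pow_le_pow_right (by norm_num) (by omega)
    have hnn : 1 ≤ n * n := Nat.mul_pos hn hn
    have hnk : n ≤ n * n := Nat.le_mul_of_pos_left n hn
    have hprod : 1 ≤ 2 ^ n * (n * n) := Nat.mul_pos h1 hnn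
    calc (n * n + n) * (2 ^ n * n * (n + n) + 2) + 1
        ≤ (2 * (n * n)) * (4 * (2 ^ n * (n * n))) + 1 := by
          gcongr
          · omega
          · nlinarith
      _ ≤ 16 * (n * n * n * n) * 2 ^ n := by nlinarith [Nat.mul_pos hnn hprod]
      _ ≤ 2 ^ (4 * n) * (2 ^ n * 2 ^ n * 2 ^ n * 2 ^ n) * 2 ^ n := by gcongr
      _ = 2 ^ (9 * n) := by ring
  have hexp : n * n + n ≤ 2 * n ^ 2 := by nlinarith
  calc ((n * n + n) * (2 ^ n * n * (n + n) + 2) + 1) ^ (n * n + n)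
      ≤ (2 ^ (9 * n)) ^ (n * n + n) := Nat.pow_le_pow_left hbase _
    _ ≤ (2 ^ (9 * n)) ^ (2 * n ^ 2) := Nat.pow_le_pow_right (by positivity) hexp
    _ = 2 ^ (18 * n ^ 3) := by rw [← pow_mul]; ring_nf

theorem stmt3 : ∃ c₁ c₂ : ℝ, 0 < c₁ ∧ 0 < c₂ ∧ ∃ N : ℕ, ∀ n : ℕ, N ≤ n →
    (2 : ℝ) ^ (c₁ * (n : ℝ) ^ 3) ≤ (Nat.card {φ : CubeOrientation n // IsPUSO φ} : ℝ) ∧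
    (Nat.card {φ : CubeOrientation n // IsPUSO φ} : ℝ) ≤ (2 : ℝ) ^ (c₂ * (n : ℝ) ^ 3) := by
  refine ⟨1 / 216, 18, by norm_num, by norm_num, 3, fun n hn => ⟨?_, ?_⟩⟩
  · have hlow := two_pow_le_card_PUSO (m := n / 3) (n := n) (by omega)
    have hm : (n : ℝ) / 6 ≤ ((n / 3 : ℕ) : ℝ) := by
      have : n ≤ 6 * (n / 3) := by omega
      have : (n : ℝ) ≤ 6 * ((n / 3 : ℕ) : ℝ) := by exact_mod_cast this
      linarith
    calc (2 : ℝ) ^ (1 / 216 * (n : ℝ) ^ 3) ≤ (2 : ℝ) ^ ((((n / 3) ^ 3 : ℕ) : ℝ)) := by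
          refine Real.rpow_le_rpow_of_exponent_le (by norm_num) ?_
          have h3 : ((n : ℝ) / 6) ^ 3 ≤ ((n / 3 : ℕ) : ℝ) ^ 3 := by gcongr
          push_cast at h3 ⊢
          calc 1 / 216 * (n : ℝ) ^ 3 = ((n : ℝ) / 6) ^ 3 := by ring
            _ ≤ _ := h3
      _ = ((2 ^ (n / 3) ^ 3 : ℕ) : ℝ) := by rw [Real.rpow_natCast]; push_cast; rfl
      _ ≤ _ := by exact_mod_cast hlow
  · have hup := card_PUSO_le (n := n) (by omega)
    calc (Nat.card {φ : CubeOrientation n // IsPUSO φ} : ℝ) ≤ ((2 ^ (18 * n ^ 3) : ℕ) : ℝ) := by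
          exact_mod_cast hup
      _ = (2 : ℝ) ^ (18 * (n : ℝ) ^ 3) := by
          rw [show (18 * (n : ℝ) ^ 3) = ((18 * n ^ 3 : ℕ) : ℝ) by push_cast; ring,
            Real.rpow_natCast]
          push_cast
          rfl
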